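/- If all off-diagonal entries of R are strictly positive (R_{ij} > 0 whenever i ≠ j) and every principal submatrix of R (the submatrix with rows and columns indexed by any nonempty subset of {1,…,d}) is invertible, then with probability one the sequence V(n) converges as n → ∞. -/

import Mathlib

open MeasureTheory Filter Finset

namespace VRRW

noncomputable def simplex (d : ℕ) : Set (Fin d → ℝ) :=
  {v | (∀ i, 0 ≤ v i) ∧ ∑ i, v i = 1}

noncomputable def Nvec {d : ℕ} (R : Matrix (Fin d) (Fin d) ℝ) (v : Fin d → ℝ) (i : Fin d) : ℝ :=
  ∑ j, R i j * v j

noncomputable def Hfun {d : ℕ} (R : Matrix (Fin d) (Fin d) ℝ) (v : Fin d → ℝ) : ℝ :=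
  ∑ i, ∑ j, R i j * v i * v j

noncomputable def piVec {d : ℕ} (R : Matrix (Fin d) (Fin d) ℝ) (v : Fin d → ℝ) : Fin d → ℝ :=
  fun i => v i * Nvec R v i / Hfun R v

noncomputable def Mmat {d : ℕ} (R : Matrix (Fin d) (Fin d) ℝ) (v : Fin d → ℝ) :
    Matrix (Fin d) (Fin d) ℝ :=
  fun i j => R i j * v j / Nvec R v i

noncomputable def critSet {d : ℕ} (R : Matrix (Fin d) (Fin d) ℝ) : Set (Fin d → ℝ) :=
  {v | v ∈ simplex d ∧ 0 < Hfun R v ∧ piVec R v = v}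

noncomputable def degenSet {d : ℕ} (R : Matrix (Fin d) (Fin d) ℝ) : Set (Fin d → ℝ) :=
  {v | v ∈ simplex d ∧ ((∃ i, Nvec R v i = 0) ∨ ∃ i j, ∀ k, 1 ≤ k → (Mmat R v ^ k) i j = 0)}

/-- `S_i(n)`: one plus the number of visits to state `i` strictly after time `d`, up to time `n`. -/
noncomputable def visits {d : ℕ} {Ω : Type*} (Y : ℕ → Ω → Fin d) (n : ℕ) (ω : Ω) (i : Fin d) : ℝ :=
  1 + (((Finset.Ioc d n).filter fun m => Y m ω = i).card : ℝ)

/-- `V(n) = S(n)/n`, the fractional occupation vector. -/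
noncomputable def occup {d : ℕ} {Ω : Type*} (Y : ℕ → Ω → Fin d) (n : ℕ) (ω : Ω) : Fin d → ℝ :=
  fun i => visits Y n ω i / n

/-- The natural filtration `F_n = σ(Y_d, …, Y_n)`. -/
def natFilt {d : ℕ} {Ω : Type*} (Y : ℕ → Ω → Fin d) (n : ℕ) : MeasurableSpace Ω :=
  ⨆ m ∈ Finset.Icc d n, MeasurableSpace.comap (Y m) ⊤

/-- The defining properties of the vertex-reinforced random walk driven by `R`:
measurability, start `Y_d = 1` (state `1` is encoded as index `0` of `Fin d`), and the
reinforced transition probabilities, expressed via conditional expectation of indicators. -/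
def IsVRRW {d : ℕ} {Ω : Type*} [MeasurableSpace Ω] (μ : Measure Ω)
    (R : Matrix (Fin d) (Fin d) ℝ) (Y : ℕ → Ω → Fin d) : Prop :=
  (∀ n, Measurable (Y n)) ∧
  (∀ ω, (Y d ω : ℕ) = 0) ∧
  (∀ n, d ≤ n → ∀ j : Fin d,
    (μ[(fun ω => if Y (n + 1) ω = j then (1 : ℝ) else 0) | natFilt Y n])
      =ᵐ[μ] fun ω => R (Y n ω) j * visits Y n ω j / ∑ i, R (Y n ω) i * visits Y n ω i)

/-- Euclidean distance from a point to a set: `inf {|x − y| : y ∈ A}`. -/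
noncomputable def distToSet {d : ℕ} (x : Fin d → ℝ) (A : Set (Fin d → ℝ)) : ℝ :=
  sInf ((fun y => Real.sqrt (∑ i, (x i - y i) ^ 2)) '' A)

end VRRW

open VRRW MeasureTheory Filter

namespace VRRW

/-- Nonnegative numbers with `∑ γ x < ∞`, `∑ γ = ∞` and increments `O(γ)` tend to zero. -/
theorem tendsto_zero_of_summable_mul {x γ : ℕ → ℝ} {C : ℝ} (hx : ∀ k, 0 ≤ x k)
    (hγ : ∀ k, 0 ≤ γ k) (hstep : ∀ k, |x (k + 1) - x k| ≤ C * γ k)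
    (hsq : Summable fun k => γ k ^ 2) (hdiv : ¬ Summable γ)
    (hsum : Summable fun k => γ k * x k) : Tendsto x atTop (nhds 0) := by
  have hcauchy : CauchySeq fun k => x k ^ 2 := by
    apply cauchySeq_of_summable_dist
    refine Summable.of_nonneg_of_le (fun k => dist_nonneg) (fun k => ?_)
      ((hsum.mul_left (2 * C)).add (hsq.mul_left (C ^ 2)))
    rw [dist_comm, Real.dist_eq, Nat.succ_eq_add_one, sq_sub_sq, abs_mul,
      abs_of_nonneg (add_nonneg (hx _) (hx _))]
    have h1 := hstep k
    have h2 : x (k + 1) + x k ≤ 2 * x k + C * γ k := by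
      have := le_abs_self (x (k + 1) - x k)
      linarith
    calc (x (k + 1) + x k) * |x (k + 1) - x k|
        ≤ (2 * x k + C * γ k) * (C * γ k) := by
          refine mul_le_mul h2 h1 (abs_nonneg _) ?_
          linarith [hx k, (abs_nonneg _).trans h1]
      _ = 2 * C * (γ k * x k) + C ^ 2 * γ k ^ 2 := by ring
  obtain ⟨L, hL⟩ := cauchySeq_tendsto_of_complete hcauchy
  have hsqrt : Tendsto x atTop (nhds (Real.sqrt L)) := by
    have := (Real.continuous_sqrt.tendsto L).comp hL
    refine this.congr fun k => ?_
    simp [Real.sqrt_sq (hx k)]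
  rcases (Real.sqrt_nonneg L).eq_or_lt with h0 | hpos
  · rwa [← h0] at hsqrt
  exfalso
  apply hdiv
  have hev : ∀ᶠ k in atTop, Real.sqrt L / 2 < x k :=
    hsqrt.eventually (lt_mem_nhds (by linarith))
  have hs := hsum.mul_left (2 / Real.sqrt L)
  refine Summable.of_norm_bounded_eventually_nat hs ?_
  filter_upwards [hev] with k hk
  rw [Real.norm_of_nonneg (hγ k)]
  have : 1 ≤ 2 / Real.sqrt L * x k := by
    rw [div_mul_eq_mul_div, le_div_iff₀ hpos]
    linarith
  calc γ k = γ k * 1 := (mul_one _).symm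
    _ ≤ γ k * (2 / Real.sqrt L * x k) := mul_le_mul_of_nonneg_left this (hγ k)
    _ = 2 / Real.sqrt L * (γ k * x k) := by ring

/-- A sequence in a compact set with vanishing steps, along which a continuous function with
finitely many zeros tends to zero, converges. -/
theorem exists_tendsto_of_finite_zeros {X : Type*} [MetricSpace X] {K : Set X} (hK : IsCompact K)
    {f : X → ℝ} (hf : ContinuousOn f K) (hfin : {y ∈ K | f y = 0}.Finite) {x : ℕ → X}
    (hxK : ∀ n, x n ∈ K) (hstep : Tendsto (fun n => dist (x (n + 1)) (x n)) atTop (nhds 0))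
    (hfx : Tendsto (fun n => f (x n)) atTop (nhds 0)) : ∃ z, Tendsto x atTop (nhds z) := by
  obtain ⟨z, hzK, hz⟩ := hK.exists_mapClusterPt (u := x) (f := atTop)
    (tendsto_principal.2 (Eventually.of_forall hxK))
  refine ⟨z, ?_⟩
  obtain ⟨r, hr, hrz⟩ : ∃ r > 0, ∀ y ∈ K, f y = 0 → dist y z < r → y = z := by
    have hcl : IsClosed ({y ∈ K | f y = 0} \ {z}) := hfin.sdiff.isClosed
    have hmem : ({y ∈ K | f y = 0} \ {z})ᶜ ∈ nhds z := hcl.isOpen_compl.mem_nhds (by simp)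
    obtain ⟨r, hr, hsub⟩ := Metric.mem_nhds_iff.1 hmem
    refine ⟨r, hr, fun y hy hy0 hyd => ?_⟩
    by_contra hne
    exact hsub (Metric.mem_ball.2 hyd) ⟨⟨hy, hy0⟩, hne⟩
  rw [Metric.tendsto_atTop']
  intro ε hε
  set δ := min ε r / 2 with hδ
  have hδ0 : 0 < δ := by positivity
  have hδr : δ < r := by have := min_le_right ε r; linarith
  have hδε : δ < ε := by have := min_le_left ε r; linarith
  have hcomp : IsCompact (K ∩ {y | δ / 2 ≤ dist y z ∧ dist y z ≤ δ}) := by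
    refine hK.inter_right (IsClosed.inter ?_ ?_)
    · exact isClosed_le continuous_const (continuous_id.dist continuous_const)
    · exact isClosed_le (continuous_id.dist continuous_const) continuous_const
  have hann : ∀ᶠ n in atTop, ¬ (δ / 2 ≤ dist (x n) z ∧ dist (x n) z ≤ δ) := by
    rcases (K ∩ {y | δ / 2 ≤ dist y z ∧ dist y z ≤ δ}).eq_empty_or_nonempty with he | hne
    · refine Eventually.of_forall fun n hn => ?_
      have : x n ∈ (∅ : Set X) := he ▸ ⟨hxK n, hn⟩
      exact this
    · obtain ⟨y, hy, hmin⟩ := hcomp.exists_isMinOn hne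
        ((hf.mono Set.inter_subset_left).abs)
      have hy0 : 0 < |f y| := by
        rw [abs_pos]
        intro h0
        have hyz := hrz y hy.1 h0 (hy.2.2.trans_lt hδr)
        have := hy.2.1
        rw [hyz, dist_self] at this
        linarith
      have habs : Tendsto (fun n => |f (x n)|) atTop (nhds 0) := by simpa using hfx.abs
      filter_upwards [habs.eventually (gt_mem_nhds hy0)] with n hn hn'
      exact absurd (hmin ⟨hxK n, hn'⟩) (not_le.2 hn)
  obtain ⟨N, hN⟩ := eventually_atTop.1
    (hann.and (hstep.eventually (gt_mem_nhds (half_pos hδ0))))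
  obtain ⟨n₀, hn₀, hn₀N⟩ := ((hz.frequently
    (Metric.ball_mem_nhds z (half_pos hδ0))).and_eventually (eventually_ge_atTop N)).exists
  have hind : ∀ n ≥ n₀, dist (x n) z < δ / 2 := by
    intro n hn
    induction n, hn using Nat.le_induction with
    | base => exact hn₀
    | succ n hn ih =>
      have h1 := (hN n (hn₀N.trans hn)).2
      have h2 := (hN (n + 1) (by omega)).1
      have h3 := dist_triangle (x (n + 1)) (x n) z
      by_contra h4
      exact h2 ⟨not_lt.1 h4, by linarith⟩
  exact ⟨n₀, fun n hn => (hind n hn.le).trans (by linarith)⟩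

/-- Sup-norm stability of `x - B x = y` when `B` is nonnegative with row sums at most `1 - c`. -/
theorem norm_le_of_sub_mulVec {d : ℕ} {B : Matrix (Fin d) (Fin d) ℝ} {c : ℝ} (hc : 0 < c)
    (hB : ∀ i j, 0 ≤ B i j) (hrow : ∀ i, ∑ j, B i j ≤ 1 - c) {x y : Fin d → ℝ}
    (h : x - B.mulVec x = y) : ‖x‖ ≤ ‖y‖ / c := by
  rcases isEmpty_or_nonempty (Fin d) with hd | hd
  · rw [Subsingleton.elim x 0, norm_zero]
    positivity
  have key : ‖x‖ ≤ ‖y‖ + (1 - c) * ‖x‖ := by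
    rw [pi_norm_le_iff_of_nonempty]
    intro i
    have hi : x i = y i + ∑ j, B i j * x j := by
      rw [← h]
      simp [Matrix.mulVec, dotProduct]
    rw [hi]
    refine (norm_add_le _ _).trans (add_le_add (norm_le_pi_norm y i) ?_)
    calc ‖∑ j, B i j * x j‖ ≤ ∑ j, B i j * ‖x‖ := by
          refine norm_sum_le_of_le _ fun j _ => ?_
          rw [norm_mul, Real.norm_of_nonneg (hB i j)]
          exact mul_le_mul_of_nonneg_left (norm_le_pi_norm x j) (hB i j)
      _ = (∑ j, B i j) * ‖x‖ := by rw [Finset.sum_mul]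
      _ ≤ (1 - c) * ‖x‖ := mul_le_mul_of_nonneg_right (hrow i) (norm_nonneg _)
  rw [le_div_iff₀ hc]
  linarith

theorem exists_sub_mulVec_eq {d : ℕ} {B : Matrix (Fin d) (Fin d) ℝ} {c : ℝ} (hc : 0 < c)
    (hB : ∀ i j, 0 ≤ B i j) (hrow : ∀ i, ∑ j, B i j ≤ 1 - c) (y : Fin d → ℝ) :
    ∃ x, x - B.mulVec x = y := by
  let T : (Fin d → ℝ) →ₗ[ℝ] (Fin d → ℝ) := LinearMap.id - B.mulVecLin
  have hinj : Function.Injective T := by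
    rw [injective_iff_map_eq_zero]
    intro x hx
    have := norm_le_of_sub_mulVec (x := x) (y := 0) hc hB hrow hx
    simpa using this
  exact LinearMap.injective_iff_surjective.1 hinj y

end VRRW

namespace VRRW

variable {d : ℕ} {R : Matrix (Fin d) (Fin d) ℝ} {v : Fin d → ℝ}

/-- The growth rate of `Hfun` along the mean-field flow, up to a factor two. -/
noncomputable def drift (R : Matrix (Fin d) (Fin d) ℝ) (v : Fin d → ℝ) : ℝ :=
  (∑ j, v j * Nvec R v j ^ 2) / Hfun R v - Hfun R v

/-- `Nvec R v` minus its mean under the invariant law `piVec R v` of `Mmat R v`. -/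
noncomputable def centered (R : Matrix (Fin d) (Fin d) ℝ) (v : Fin d → ℝ) : Fin d → ℝ :=
  fun i => Nvec R v i - (∑ j, v j * Nvec R v j ^ 2) / Hfun R v

theorem isCompact_simplex : IsCompact (simplex d) := isCompact_stdSimplex ℝ (Fin d)

theorem convex_simplex : Convex ℝ (simplex d) := convex_stdSimplex ℝ (Fin d)

theorem norm_le_one_of_mem_simplex (hv : v ∈ simplex d) : ‖v‖ ≤ 1 := by
  refine (pi_norm_le_iff_of_nonneg zero_le_one).2 fun i => ?_
  rw [Real.norm_of_nonneg (hv.1 i), ← hv.2]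
  exact Finset.single_le_sum (fun j _ => hv.1 j) (Finset.mem_univ i)

theorem exists_pos_of_mem_simplex (hv : v ∈ simplex d) : ∃ j, 0 < v j := by
  by_contra! h
  have := Finset.sum_nonpos fun j (_ : j ∈ Finset.univ) => h j
  linarith [hv.2]

theorem nvec_pos (hR : ∀ i j, 0 < R i j) (hv : v ∈ simplex d) (i : Fin d) : 0 < Nvec R v i := by
  obtain ⟨j, hj⟩ := exists_pos_of_mem_simplex hv
  exact Finset.sum_pos' (fun j _ => mul_nonneg (hR i j).le (hv.1 j))
    ⟨j, Finset.mem_univ j, mul_pos (hR i j) hj⟩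

theorem hfun_eq_sum (R : Matrix (Fin d) (Fin d) ℝ) (v : Fin d → ℝ) :
    Hfun R v = ∑ i, v i * Nvec R v i := by
  simp only [Hfun, Nvec, Finset.mul_sum]
  exact Finset.sum_congr rfl fun i _ => Finset.sum_congr rfl fun j _ => by ring

theorem hfun_pos (hR : ∀ i j, 0 < R i j) (hv : v ∈ simplex d) : 0 < Hfun R v := by
  rw [hfun_eq_sum]
  obtain ⟨j, hj⟩ := exists_pos_of_mem_simplex hv
  exact Finset.sum_pos' (fun j _ => mul_nonneg (hv.1 j) (nvec_pos hR hv j).le)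
    ⟨j, Finset.mem_univ j, mul_pos hj (nvec_pos hR hv j)⟩

theorem hfun_mul_drift (hR : ∀ i j, 0 < R i j) (hv : v ∈ simplex d) :
    Hfun R v * drift R v = ∑ i, v i * (Nvec R v i - Hfun R v) ^ 2 := by
  have hH := (hfun_pos hR hv).ne'
  have h1 : ∑ i, v i * (Nvec R v i - Hfun R v) ^ 2 = ∑ i, v i * Nvec R v i ^ 2
      - 2 * Hfun R v * ∑ i, v i * Nvec R v i + Hfun R v ^ 2 * ∑ i, v i := by
    simp only [Finset.mul_sum, ← Finset.sum_sub_distrib, ← Finset.sum_add_distrib]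
    exact Finset.sum_congr rfl fun i _ => by ring
  rw [h1, ← hfun_eq_sum, hv.2, drift]
  field_simp
  ring

theorem drift_nonneg (hR : ∀ i j, 0 < R i j) (hv : v ∈ simplex d) : 0 ≤ drift R v := by
  refine nonneg_of_mul_nonneg_right ?_ (hfun_pos hR hv)
  rw [hfun_mul_drift hR hv]
  exact Finset.sum_nonneg fun i _ => mul_nonneg (hv.1 i) (sq_nonneg _)

theorem nvec_eq_hfun_of_drift_eq_zero (hR : ∀ i j, 0 < R i j) (hv : v ∈ simplex d)
    (h : drift R v = 0) {i : Fin d} (hi : v i ≠ 0) : Nvec R v i = Hfun R v := by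
  have h0 := hfun_mul_drift hR hv
  rw [h, mul_zero, eq_comm, Finset.sum_eq_zero_iff_of_nonneg
    fun i _ => mul_nonneg (hv.1 i) (sq_nonneg _)] at h0
  have := h0 i (Finset.mem_univ i)
  simpa [hi, sub_eq_zero] using this

/-- Invertible principal submatrices leave at most one zero of `drift` per support. -/
theorem finite_drift_zeros (hR : ∀ i j, 0 < R i j)
    (hminor : ∀ s : Finset (Fin d), s.Nonempty →
      IsUnit (R.submatrix (fun i : s => (i : Fin d)) (fun j : s => (j : Fin d))).det) :
    {v ∈ simplex d | drift R v = 0}.Finite := by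
  refine Set.Finite.of_finite_image (f := fun v => Finset.univ.filter fun i => v i ≠ 0)
    (Set.toFinite _) ?_
  rintro v ⟨hv, hv0⟩ v' ⟨hv', hv0'⟩ hs
  have hsupp : ∀ i, v i ≠ 0 ↔ v' i ≠ 0 := fun i => by
    simpa using Finset.ext_iff.1 hs i
  set s : Finset (Fin d) := Finset.univ.filter fun i => v i ≠ 0 with hsdef
  have hne : s.Nonempty := by
    obtain ⟨j, hj⟩ := exists_pos_of_mem_simplex hv
    exact ⟨j, by simp [hsdef, hj.ne']⟩
  have hx : ∀ i, Hfun R v' * v i - Hfun R v * v' i = 0 := by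
    have hsub : (fun i : s => Hfun R v' * v i - Hfun R v * v' i) = 0 := by
      refine Matrix.eq_zero_of_mulVec_eq_zero (hminor s hne).ne_zero (funext fun i => ?_)
      have hi : v i ≠ 0 := (Finset.mem_filter.1 i.2).2
      have e1 := nvec_eq_hfun_of_drift_eq_zero hR hv hv0 hi
      have e2 := nvec_eq_hfun_of_drift_eq_zero hR hv' hv0' ((hsupp i).1 hi)
      have e3 : ∑ j : s, R i j * (Hfun R v' * v j - Hfun R v * v' j)
          = ∑ j, R i j * (Hfun R v' * v j - Hfun R v * v' j) := by
        rw [Finset.sum_coe_sort s fun j => R i j * (Hfun R v' * v j - Hfun R v * v' j)]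
        refine Finset.sum_subset (Finset.subset_univ s) fun j _ hj => ?_
        have h1 : v j = 0 := by simpa [hsdef] using hj
        have h2 : v' j = 0 := by
          by_contra h
          exact (hsupp j).2 h h1
        simp [h1, h2]
      have e4 : ∑ j, R i j * (Hfun R v' * v j - Hfun R v * v' j)
          = Hfun R v' * Nvec R v i - Hfun R v * Nvec R v' i := by
        simp only [Nvec, Finset.mul_sum, ← Finset.sum_sub_distrib]
        exact Finset.sum_congr rfl fun j _ => by ring
      simp only [Matrix.mulVec, dotProduct, Matrix.submatrix_apply, Pi.zero_apply]
      rw [e3, e4, e1, e2]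
      ring
    intro i
    by_cases hi : v i = 0
    · have : v' i = 0 := by
        by_contra h
        exact (hsupp i).2 h hi
      simp [hi, this]
    · exact congrFun hsub ⟨i, by simp [hsdef, hi]⟩
  have hH : Hfun R v' = Hfun R v := by
    have h := Finset.sum_congr rfl fun i (_ : i ∈ Finset.univ) => hx i
    rw [Finset.sum_sub_distrib, ← Finset.mul_sum, ← Finset.mul_sum, hv.2, hv'.2] at h
    simp at h
    linarith
  funext i
  have h := hx i
  rw [hH, ← mul_sub] at h
  have := (mul_eq_zero.1 h).resolve_left (hfun_pos hR hv).ne'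
  linarith

theorem contDiff_nvec (R : Matrix (Fin d) (Fin d) ℝ) (i : Fin d) :
    ContDiff ℝ 1 fun v => Nvec R v i := by
  unfold Nvec
  fun_prop

theorem contDiff_hfun (R : Matrix (Fin d) (Fin d) ℝ) : ContDiff ℝ 1 (Hfun R) := by
  unfold Hfun
  fun_prop

theorem contDiffOn_weighted_nvec (hR : ∀ i j, 0 < R i j) :
    ContDiffOn ℝ 1 (fun v => (∑ j, v j * Nvec R v j ^ 2) / Hfun R v) (simplex d) := by
  refine ContDiffOn.div (ContDiff.contDiffOn ?_) (contDiff_hfun R).contDiffOn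
    fun v hv => (hfun_pos hR hv).ne'
  exact ContDiff.sum fun j _ => (contDiff_apply ℝ ℝ j).mul ((contDiff_nvec R j).pow 2)

theorem contDiffOn_drift (hR : ∀ i j, 0 < R i j) : ContDiffOn ℝ 1 (drift R) (simplex d) :=
  (contDiffOn_weighted_nvec hR).sub (contDiff_hfun R).contDiffOn

theorem contDiffOn_centered (hR : ∀ i j, 0 < R i j) : ContDiffOn ℝ 1 (centered R) (simplex d) :=
  contDiffOn_pi.2 fun i => (contDiff_nvec R i).contDiffOn.sub (contDiffOn_weighted_nvec hR)

theorem contDiffOn_mmat (hR : ∀ i j, 0 < R i j) (i j : Fin d) :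
    ContDiffOn ℝ 1 (fun v => Mmat R v i j) (simplex d) :=
  ContDiffOn.div (contDiff_const.mul (contDiff_apply ℝ ℝ j)).contDiffOn
    (contDiff_nvec R i).contDiffOn fun _ hv => (nvec_pos hR hv i).ne'

/-- A `C¹` function on the simplex is bounded and Lipschitz there. -/
theorem exists_bound_lipschitz {F : Type*} [NormedAddCommGroup F] [NormedSpace ℝ F]
    {f : (Fin d → ℝ) → F} (hf : ContDiffOn ℝ 1 f (simplex d)) :
    ∃ C, 0 ≤ C ∧ (∀ v ∈ simplex d, ‖f v‖ ≤ C) ∧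
      ∀ v ∈ simplex d, ∀ v' ∈ simplex d, ‖f v - f v'‖ ≤ C * ‖v - v'‖ := by
  obtain ⟨K, hK⟩ := hf.exists_lipschitzOnWith one_ne_zero convex_simplex isCompact_simplex
  obtain ⟨B, hB⟩ := isCompact_simplex.exists_bound_of_continuousOn hf.continuousOn
  refine ⟨max K B, le_max_of_le_left K.2, fun v hv => (hB v hv).trans (le_max_right _ _),
    fun v hv v' hv' => ?_⟩
  rw [← dist_eq_norm, ← dist_eq_norm]
  exact (hK.dist_le_mul v hv v' hv').trans
    (mul_le_mul_of_nonneg_right (le_max_left _ _) dist_nonneg)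

theorem mmat_nonneg (hR : ∀ i j, 0 < R i j) (hv : v ∈ simplex d) (i j : Fin d) :
    0 ≤ Mmat R v i j :=
  div_nonneg (mul_nonneg (hR i j).le (hv.1 j)) (nvec_pos hR hv i).le

theorem sum_mmat (hR : ∀ i j, 0 < R i j) (hv : v ∈ simplex d) (i : Fin d) :
    ∑ j, Mmat R v i j = 1 := by
  simp only [Mmat, ← Finset.sum_div]
  exact div_self (nvec_pos hR hv i).ne'

/-- Doeblin minorization of `Mmat R v` by `v`, uniformly over the simplex. -/
theorem exists_mmat_minorization (hR : ∀ i j, 0 < R i j) :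
    ∃ c > 0, ∀ v ∈ simplex d, ∀ i j, c * v j ≤ Mmat R v i j := by
  rcases isEmpty_or_nonempty (Fin d) with hd | hd
  · exact ⟨1, one_pos, fun v _ i => isEmptyElim i⟩
  obtain ⟨p, hp⟩ := Finite.exists_min fun p : Fin d × Fin d => R p.1 p.2
  obtain ⟨q, hq⟩ := Finite.exists_max fun p : Fin d × Fin d => R p.1 p.2
  refine ⟨R p.1 p.2 / R q.1 q.2, div_pos (hR _ _) (hR _ _), fun v hv i j => ?_⟩
  have hN : Nvec R v i ≤ R q.1 q.2 := by
    calc Nvec R v i ≤ ∑ j, R q.1 q.2 * v j :=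
          Finset.sum_le_sum fun j _ => mul_le_mul_of_nonneg_right (hq (i, j)) (hv.1 j)
      _ = R q.1 q.2 := by rw [← Finset.mul_sum, hv.2, mul_one]
  rw [Mmat, div_mul_eq_mul_div]
  exact div_le_div₀ (mul_nonneg (hR i j).le (hv.1 j))
    (mul_le_mul_of_nonneg_right (hp (i, j)) (hv.1 j)) (nvec_pos hR hv i) hN

theorem sum_mul_nvec_mul_mulVec (hsymm : R.IsSymm) (hR : ∀ i j, 0 < R i j) (hv : v ∈ simplex d)
    (x : Fin d → ℝ) :
    ∑ i, v i * Nvec R v i * (Mmat R v).mulVec x i = ∑ i, v i * Nvec R v i * x i := by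
  have h : ∀ i, v i * Nvec R v i * (Mmat R v).mulVec x i = ∑ j, v i * R i j * v j * x j := by
    intro i
    have := (nvec_pos hR hv i).ne'
    simp only [Matrix.mulVec, dotProduct, Mmat, Finset.mul_sum]
    refine Finset.sum_congr rfl fun j _ => ?_
    field_simp
  rw [Finset.sum_congr rfl fun i _ => h i, Finset.sum_comm]
  refine Finset.sum_congr rfl fun j _ => ?_
  simp only [Nvec, Finset.mul_sum, Finset.sum_mul]
  refine Finset.sum_congr rfl fun i _ => ?_
  rw [hsymm.apply j i]
  ring

theorem sum_mul_nvec_mul_centered (hR : ∀ i j, 0 < R i j) (hv : v ∈ simplex d) :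
    ∑ i, v i * Nvec R v i * centered R v i = 0 := by
  have hH := (hfun_pos hR hv).ne'
  have : ∑ i, v i * Nvec R v i * centered R v i = ∑ i, v i * Nvec R v i ^ 2
      - (∑ i, v i * Nvec R v i) * ((∑ j, v j * Nvec R v j ^ 2) / Hfun R v) := by
    rw [Finset.sum_mul, ← Finset.sum_sub_distrib]
    exact Finset.sum_congr rfl fun i _ => by rw [centered]; ring
  rw [this, ← hfun_eq_sum]
  field_simp
  ring

/-- Bounded, Lipschitz solution of the Poisson equation for `Mmat R v` and `Nvec R v`. -/
theorem exists_poisson (hsymm : R.IsSymm) (hR : ∀ i j, 0 < R i j) :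
    ∃ u : (Fin d → ℝ) → Fin d → ℝ, ∃ C, 0 ≤ C ∧
      (∀ v ∈ simplex d, u v - (Mmat R v).mulVec (u v) = centered R v) ∧
      (∀ v ∈ simplex d, ‖u v‖ ≤ C) ∧
      ∀ v ∈ simplex d, ∀ v' ∈ simplex d, ‖u v - u v'‖ ≤ C * ‖v - v'‖ := by
  obtain ⟨c, hc, hcM⟩ := exists_mmat_minorization hR
  let B : (Fin d → ℝ) → Matrix (Fin d) (Fin d) ℝ := fun v => Matrix.of fun i j =>
    Mmat R v i j - c * v j
  have hB0 : ∀ v ∈ simplex d, ∀ i j, 0 ≤ B v i j := fun v hv i j => sub_nonneg.2 (hcM v hv i j)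
  have hBrow : ∀ v ∈ simplex d, ∀ i, ∑ j, B v i j ≤ 1 - c := fun v hv i => by
    simp only [B, Matrix.of_apply, Finset.sum_sub_distrib, ← Finset.mul_sum, sum_mmat hR hv, hv.2,
      mul_one, le_refl]
  have hex : ∀ v, ∃ x : Fin d → ℝ, v ∈ simplex d → x - (B v).mulVec x = centered R v := by
    intro v
    by_cases hv : v ∈ simplex d
    · obtain ⟨x, hx⟩ := exists_sub_mulVec_eq hc (hB0 v hv) (hBrow v hv) (centered R v)
      exact ⟨x, fun _ => hx⟩
    · exact ⟨0, fun h => absurd h hv⟩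
  choose u hu using hex
  obtain ⟨C₁, hC₁, hbd, hlip⟩ := exists_bound_lipschitz (contDiffOn_centered hR)
  have hBsmooth : ContDiffOn ℝ 1 (fun v => fun i j => B v i j) (simplex d) :=
    contDiffOn_pi.2 fun i => contDiffOn_pi.2 fun j =>
      (contDiffOn_mmat hR i j).sub (contDiff_const.mul (contDiff_apply ℝ ℝ j)).contDiffOn
  obtain ⟨C₂, hC₂, -, hBlip⟩ := exists_bound_lipschitz hBsmooth
  have hubd : ∀ v ∈ simplex d, ‖u v‖ ≤ C₁ / c := fun v hv =>
    (norm_le_of_sub_mulVec hc (hB0 v hv) (hBrow v hv) (hu v hv)).trans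
      (div_le_div_of_nonneg_right (hbd v hv) hc.le)
  refine ⟨u, max (C₁ / c) ((C₁ + d * (C₂ * (C₁ / c))) / c), le_max_of_le_left (by positivity),
    fun v hv => ?_, fun v hv => (hubd v hv).trans (le_max_left _ _), fun v hv v' hv' => ?_⟩
  · have hBu : (B v).mulVec (u v) = (Mmat R v).mulVec (u v) - fun _ => c * ∑ j, v j * u v j := by
      funext i
      simp only [B, Matrix.mulVec, dotProduct, Matrix.of_apply, Pi.sub_apply, sub_mul,
        Finset.sum_sub_distrib, Finset.mul_sum, mul_assoc]
    have h1 : ∀ i, u v i - (Mmat R v).mulVec (u v) i + c * ∑ j, v j * u v j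
        = centered R v i := fun i => by
      have := congrFun (hu v hv) i
      rw [hBu] at this
      simp only [Pi.sub_apply] at this
      linarith
    have h2 := sum_mul_nvec_mul_centered hR hv
    have h3 := sum_mul_nvec_mul_mulVec hsymm hR hv (u v)
    have h4 : ∑ i, v i * Nvec R v i * centered R v i
        = Hfun R v * (c * ∑ j, v j * u v j) := by
      simp only [← h1, mul_add, mul_sub, Finset.sum_add_distrib, Finset.sum_sub_distrib, h3, sub_self,
        zero_add]
      rw [hfun_eq_sum, Finset.sum_mul]
    have h5 : c * ∑ j, v j * u v j = 0 := by
      rw [h2] at h4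
      exact (mul_eq_zero.1 h4.symm).resolve_left (hfun_pos hR hv).ne'
    funext i
    rw [← h1 i, h5, add_zero, Pi.sub_apply]
  · have hdiff : (u v - u v') - (B v).mulVec (u v - u v')
        = (centered R v - centered R v') + (B v - B v').mulVec (u v') := by
      rw [← hu v hv, ← hu v' hv', Matrix.mulVec_sub, Matrix.sub_mulVec]
      abel
    have hentry : ∀ i j, |B v i j - B v' i j| ≤ C₂ * ‖v - v'‖ := fun i j =>
      (norm_le_pi_norm (fun j => B v i j - B v' i j) j).trans
        ((norm_le_pi_norm (fun i j => B v i j - B v' i j) i).trans (hBlip v hv v' hv'))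
    have hmul : ‖(B v - B v').mulVec (u v')‖ ≤ d * (C₂ * (C₁ / c)) * ‖v - v'‖ := by
      refine (pi_norm_le_iff_of_nonneg (by positivity)).2 fun i => ?_
      calc ‖∑ j, (B v - B v') i j * u v' j‖
          ≤ ∑ _j : Fin d, C₂ * ‖v - v'‖ * (C₁ / c) := by
            refine norm_sum_le_of_le _ fun j _ => ?_
            rw [norm_mul]
            exact mul_le_mul (hentry i j) ((norm_le_pi_norm _ j).trans (hubd v' hv'))
              (norm_nonneg _) (by positivity)
        _ = d * (C₂ * (C₁ / c)) * ‖v - v'‖ := by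
            simp only [Finset.sum_const, Finset.card_univ, Fintype.card_fin, nsmul_eq_mul]
            ring
    refine (norm_le_of_sub_mulVec hc (hB0 v hv) (hBrow v hv) hdiff).trans ?_
    refine le_trans ?_ (mul_le_mul_of_nonneg_right (le_max_right _ _) (norm_nonneg _))
    rw [div_mul_eq_mul_div]
    refine div_le_div_of_nonneg_right ((norm_add_le _ _).trans ?_) hc.le
    rw [add_mul]
    exact add_le_add (hlip v hv v' hv') hmul

theorem hfun_add (hsymm : R.IsSymm) (v x : Fin d → ℝ) :
    Hfun R (v + x) = Hfun R v + 2 * ∑ i, x i * Nvec R v i + Hfun R x := by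
  have h : ∑ i, ∑ j, R i j * v i * x j = ∑ i, x i * Nvec R v i := by
    rw [Finset.sum_comm]
    simp only [Nvec, Finset.mul_sum]
    refine Finset.sum_congr rfl fun j _ => Finset.sum_congr rfl fun i _ => ?_
    rw [hsymm.apply j i]
    ring
  have h' : ∑ i, ∑ j, R i j * x i * v j = ∑ i, x i * Nvec R v i := by
    simp only [Nvec, Finset.mul_sum]
    exact Finset.sum_congr rfl fun j _ => Finset.sum_congr rfl fun i _ => by ring
  rw [two_mul, ← add_assoc]
  nth_rewrite 1 [← h]
  rw [← h']
  simp only [Hfun, ← Finset.sum_add_distrib]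
  exact Finset.sum_congr rfl fun j _ => Finset.sum_congr rfl fun i _ => by
    simp only [Pi.add_apply]
    ring

theorem abs_hfun_le (hR : ∀ i j, 0 < R i j) {x : Fin d → ℝ} {γ : ℝ} (hx : ∀ i, |x i| ≤ γ) :
    |Hfun R x| ≤ (∑ i, ∑ j, R i j) * γ ^ 2 := by
  rw [Hfun, Finset.sum_mul]
  refine (Finset.abs_sum_le_sum_abs _ _).trans (Finset.sum_le_sum fun i _ => ?_)
  rw [Finset.sum_mul]
  refine (Finset.abs_sum_le_sum_abs _ _).trans (Finset.sum_le_sum fun j _ => ?_)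
  rw [abs_mul, abs_mul, abs_of_pos (hR i j), mul_assoc, pow_two]
  exact mul_le_mul_of_nonneg_left
    (mul_le_mul (hx i) (hx j) (abs_nonneg _) ((abs_nonneg _).trans (hx i))) (hR i j).le

theorem abs_single_sub_le_one (hv : v ∈ simplex d) (y i : Fin d) :
    |(Pi.single y 1 - v : Fin d → ℝ) i| ≤ 1 := by
  have h0 := hv.1 i
  have h1 : v i ≤ 1 := (le_abs_self _).trans ((norm_le_pi_norm v i).trans
    (norm_le_one_of_mem_simplex hv))
  rw [Pi.sub_apply, Pi.single_apply, abs_le]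
  split_ifs <;> constructor <;> linarith

/-- A bounded potential along the walk: its one-step growth dominates `drift`, up to a
conditionally centered term and a summable error. -/
theorem exists_potential (hsymm : R.IsSymm) (hR : ∀ i j, 0 < R i j) :
    ∃ u : (Fin d → ℝ) → Fin d → ℝ, ∃ Φ : ℕ → (Fin d → ℝ) → Fin d → ℝ, ∃ C,
      (∀ v ∈ simplex d, ∀ i, |u v i| ≤ C) ∧ (∀ n, ∀ v ∈ simplex d, ∀ i, |Φ n v i| ≤ C) ∧
      ∀ (n : ℕ), ∀ v ∈ simplex d, ∀ v' ∈ simplex d, ∀ y y' : Fin d,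
        v' = v + ((n : ℝ) + 1)⁻¹ • (Pi.single y' 1 - v) →
        2 * (((n : ℝ) + 1)⁻¹ * drift R v)
          + 2 * ((n : ℝ) + 1)⁻¹ * (u v y' - (Mmat R v).mulVec (u v) y)
          ≤ Φ (n + 1) v' y' - Φ n v y + C * ((n : ℝ) + 1)⁻¹ ^ 2 := by
  obtain ⟨u, C₁, hC₁, hpois, hubd, hulip⟩ := exists_poisson hsymm hR
  obtain ⟨C₂, hC₂, hcbd, hclip⟩ := exists_bound_lipschitz (contDiffOn_centered hR)
  obtain ⟨C₃, hC₃, hHbd, -⟩ := exists_bound_lipschitz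
    ((contDiff_hfun R).contDiffOn (s := simplex d))
  set w : (Fin d → ℝ) → Fin d → ℝ := fun v => u v - centered R v with hw
  have hwM : ∀ v ∈ simplex d, (Mmat R v).mulVec (u v) = w v := fun v hv => by
    simp only [hw]
    rw [← hpois v hv, sub_sub_cancel]
  have hwbd : ∀ v ∈ simplex d, ∀ i, |w v i| ≤ C₁ + C₂ := fun v hv i =>
    (norm_le_pi_norm (w v) i).trans
      ((norm_sub_le _ _).trans (add_le_add (hubd v hv) (hcbd v hv)))
  have hwlip : ∀ v ∈ simplex d, ∀ v' ∈ simplex d, ∀ i,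
      |w v i - w v' i| ≤ (C₁ + C₂) * ‖v - v'‖ := fun v hv v' hv' i => by
    refine (norm_le_pi_norm (w v - w v') i).trans ?_
    have : w v - w v' = (u v - u v') - (centered R v - centered R v') := by
      simp only [hw]
      abel
    rw [this, add_mul]
    exact (norm_sub_le _ _).trans (add_le_add (hulip v hv v' hv') (hclip v hv v' hv'))
  have hRsum : 0 ≤ ∑ i, ∑ j, R i j :=
    Finset.sum_nonneg fun i _ => Finset.sum_nonneg fun j _ => (hR i j).le
  have hγ1 : ∀ n : ℕ, ((n : ℝ) + 1)⁻¹ ≤ 1 := fun n =>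
    inv_le_one_of_one_le₀ (by linarith [(Nat.cast_nonneg n : (0 : ℝ) ≤ n)])
  refine ⟨u, fun n v y => Hfun R v + 2 * ((n : ℝ) + 1)⁻¹ * w v y,
    C₃ + 4 * (C₁ + C₂) + ∑ i, ∑ j, R i j,
    fun v hv i => ((norm_le_pi_norm (u v) i).trans (hubd v hv)).trans (by linarith),
    fun n v hv i => ?_, fun n v hv v' hv' y y' hvv' => ?_⟩
  · refine (abs_add_le _ _).trans ?_
    have h1 : |Hfun R v| ≤ C₃ := hHbd v hv
    have h2 : |2 * ((n : ℝ) + 1)⁻¹ * w v i| ≤ 2 * (C₁ + C₂) := by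
      rw [abs_mul, abs_of_nonneg (by positivity)]
      exact mul_le_mul (by linarith [hγ1 n]) (hwbd v hv i) (abs_nonneg _) (by norm_num)
    linarith
  · rw [hwM v hv]
    set γ : ℝ := ((n : ℝ) + 1)⁻¹ with hγ
    set γ' : ℝ := (((n + 1 : ℕ) : ℝ) + 1)⁻¹ with hγ'
    have hγ0 : 0 ≤ γ := by positivity
    have hγ'0 : 0 ≤ γ' := by positivity
    have hγγ' : γ' ≤ γ := by
      rw [hγ, hγ']
      push_cast
      gcongr
      linarith
    have hsub : γ - γ' ≤ γ ^ 2 := by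
      have : γ - γ' = γ * γ' := by
        rw [hγ, hγ']
        push_cast
        field_simp
        ring
      rw [this, pow_two]
      exact mul_le_mul_of_nonneg_left hγγ' hγ0
    have hδ : ∀ i, |(γ • (Pi.single y' 1 - v) : Fin d → ℝ) i| ≤ γ := fun i => by
      rw [Pi.smul_apply, smul_eq_mul, abs_mul, abs_of_nonneg hγ0]
      exact mul_le_of_le_one_right hγ0 (abs_single_sub_le_one hv y' i)
    have hnorm : ‖v' - v‖ ≤ γ := by
      rw [hvv', add_sub_cancel_left]
      exact (pi_norm_le_iff_of_nonneg hγ0).2 hδ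
    have hH : Hfun R v' = Hfun R v + 2 * (γ * (Nvec R v y' - Hfun R v))
        + Hfun R (γ • (Pi.single y' 1 - v)) := by
      rw [hvv', hfun_add hsymm, hfun_eq_sum R v]
      congr 3
      simp only [Pi.smul_apply, Pi.sub_apply, smul_eq_mul, mul_sub, sub_mul,
        Finset.sum_sub_distrib, Pi.single_apply, mul_ite, ite_mul, mul_one, mul_zero, zero_mul,
        Finset.sum_ite_eq', Finset.mem_univ, if_true, Finset.mul_sum, mul_assoc]
    have hE := (abs_le.1 (abs_hfun_le hR hδ)).1
    have hN : Nvec R v y' - Hfun R v = drift R v + (u v y' - w v y') := by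
      simp only [hw, centered, drift, Pi.sub_apply]
      ring
    have e1 : -((C₁ + C₂) * γ) ≤ w v' y' - w v y' :=
      (neg_le_neg (mul_le_mul_of_nonneg_left hnorm (add_nonneg hC₁ hC₂))).trans
        (abs_le.1 (hwlip v' hv' v hv y')).1
    have e2 := (abs_le.1 (hwbd v hv y')).2
    have e3 : -((C₁ + C₂) * γ ^ 2) ≤ γ' * (w v' y' - w v y') := by
      have h1 := mul_le_mul_of_nonneg_left e1 hγ'0
      have h2 : γ' * ((C₁ + C₂) * γ) ≤ γ * ((C₁ + C₂) * γ) :=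
        mul_le_mul_of_nonneg_right hγγ' (mul_nonneg (add_nonneg hC₁ hC₂) hγ0)
      linarith
    have e4 : (γ - γ') * w v y' ≤ (C₁ + C₂) * γ ^ 2 := by
      have h1 := mul_le_mul_of_nonneg_left e2 (sub_nonneg.2 hγγ')
      have h2 := mul_le_mul_of_nonneg_right hsub (add_nonneg hC₁ hC₂)
      linarith
    have e5 : 0 ≤ C₃ * γ ^ 2 := mul_nonneg hC₃ (sq_nonneg γ)
    simp only [← hγ, ← hγ']
    rw [hH, hN]
    linarith

variable {Ω : Type*} {Y : ℕ → Ω → Fin d}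

theorem sum_visits {n : ℕ} (hn : d ≤ n) (ω : Ω) : ∑ i, visits Y n ω i = n := by
  simp only [visits, Finset.sum_add_distrib, ← Nat.cast_sum]
  rw [Finset.sum_card_fiberwise_eq_card_filter]
  simp [Nat.cast_sub hn]

theorem visits_succ {n : ℕ} (hn : d ≤ n) (ω : Ω) (i : Fin d) :
    visits Y (n + 1) ω i = visits Y n ω i + (Pi.single (Y (n + 1) ω) 1 : Fin d → ℝ) i := by
  have : Finset.Ioc d (n + 1) = insert (n + 1) (Finset.Ioc d n) := by
    ext m
    simp only [Finset.mem_Ioc, Finset.mem_insert]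
    omega
  rw [visits, visits, this, Finset.filter_insert, Pi.single_apply]
  by_cases h : Y (n + 1) ω = i
  · rw [if_pos h, if_pos h.symm, Finset.card_insert_of_notMem (by simp)]
    push_cast
    ring
  · rw [if_neg h, if_neg (Ne.symm h), add_zero]

theorem occup_mem_simplex (hd : 0 < d) {n : ℕ} (hn : d ≤ n) (ω : Ω) :
    occup Y n ω ∈ simplex d := by
  have hn0 : (n : ℝ) ≠ 0 := by
    exact_mod_cast (hd.trans_le hn).ne'
  refine ⟨fun i => ?_, ?_⟩
  · rw [occup, visits]
    positivity
  · simp only [occup, ← Finset.sum_div]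
    rw [sum_visits hn, div_self hn0]

theorem occup_succ (hd : 0 < d) {n : ℕ} (hn : d ≤ n) (ω : Ω) :
    occup Y (n + 1) ω = occup Y n ω
      + ((n : ℝ) + 1)⁻¹ • (Pi.single (Y (n + 1) ω) 1 - occup Y n ω) := by
  have hn0 : (n : ℝ) ≠ 0 := by
    exact_mod_cast (hd.trans_le hn).ne'
  funext i
  simp only [occup, Pi.add_apply, Pi.smul_apply, Pi.sub_apply, smul_eq_mul, visits_succ hn]
  push_cast
  field_simp
  ring

theorem norm_occup_succ_sub_le (hd : 0 < d) {n : ℕ} (hn : d ≤ n) (ω : Ω) :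
    ‖occup Y (n + 1) ω - occup Y n ω‖ ≤ ((n : ℝ) + 1)⁻¹ := by
  rw [occup_succ hd hn, add_sub_cancel_left, norm_smul, Real.norm_of_nonneg (by positivity)]
  exact mul_le_of_le_one_right (by positivity) ((pi_norm_le_iff_of_nonneg zero_le_one).2 fun i =>
    abs_single_sub_le_one (occup_mem_simplex hd hn ω) _ i)

theorem mmat_occup (hd : 0 < d) {n : ℕ} (hn : d ≤ n) (ω : Ω) (j : Fin d) :
    Mmat R (occup Y n ω) (Y n ω) j
      = R (Y n ω) j * visits Y n ω j / ∑ i, R (Y n ω) i * visits Y n ω i := by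
  have hn0 : (n : ℝ) ≠ 0 := by
    exact_mod_cast (hd.trans_le hn).ne'
  simp only [Mmat, Nvec, occup, ← mul_div_assoc, ← Finset.sum_div]
  rw [div_div_div_cancel_right₀ hn0]

theorem measurable_natFilt_apply {m n : ℕ} (hm : d ≤ m) (hmn : m ≤ n) :
    Measurable[natFilt Y n] (Y m) := by
  rw [measurable_iff_comap_le]
  exact le_iSup₂_of_le m (Finset.mem_Icc.2 ⟨hm, hmn⟩) le_rfl

/-- Every function of the current occupation vector and state is measurable with respect to the
past, as the pair takes countably many values. -/
theorem measurable_natFilt_state {β : Type*} [MeasurableSpace β] {n : ℕ} (hn : d ≤ n)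
    (f : (Fin d → ℝ) → Fin d → β) :
    Measurable[natFilt Y n] fun ω => f (occup Y n ω) (Y n ω) := by
  let _ : MeasurableSpace Ω := natFilt Y n
  let S : Ω → Fin d → ℕ := fun ω i => ∑ m ∈ Finset.Ioc d n, if Y m ω = i then 1 else 0
  have hS : Measurable S := measurable_pi_lambda _ fun i =>
    Finset.measurable_fun_sum _ fun m hm =>
      Measurable.ite (measurable_natFilt_apply (Finset.mem_Ioc.1 hm).1.le (Finset.mem_Ioc.1 hm).2
        (measurableSet_singleton i)) measurable_const measurable_const
  have hg : Measurable fun p : (Fin d → ℕ) × Fin d =>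
      f (fun i => (1 + (p.1 i : ℝ)) / n) p.2 := Measurable.of_discrete
  have := hg.comp (hS.prodMk (measurable_natFilt_apply (Y := Y) hn le_rfl))
  convert this using 2 with ω
  simp only [Function.comp_apply, S, Finset.sum_boole, Nat.cast_id]
  rfl

theorem state_succ_eq_sum (f : (Fin d → ℝ) → Fin d → ℝ) (n : ℕ) (ω : Ω) :
    f (occup Y n ω) (Y (n + 1) ω)
      = ∑ j, f (occup Y n ω) j * if Y (n + 1) ω = j then 1 else 0 := by
  simp

variable [MeasurableSpace Ω] {μ : Measure Ω}

theorem natFilt_le (hY : ∀ n, Measurable (Y n)) (n : ℕ) :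
    natFilt Y n ≤ (inferInstance : MeasurableSpace Ω) :=
  iSup₂_le fun m _ => (hY m).comap_le

theorem measurable_state (hY : ∀ n, Measurable (Y n)) {β : Type*} [MeasurableSpace β] {n : ℕ}
    (hn : d ≤ n) (f : (Fin d → ℝ) → Fin d → β) :
    Measurable fun ω => f (occup Y n ω) (Y n ω) :=
  (measurable_natFilt_state hn f).mono (natFilt_le hY n) le_rfl

theorem integrable_state [IsFiniteMeasure μ] (hd : 0 < d) (hY : ∀ n, Measurable (Y n)) {n : ℕ}
    (hn : d ≤ n) {f : (Fin d → ℝ) → Fin d → ℝ} {C : ℝ} (hf : ∀ v ∈ simplex d, ∀ i, |f v i| ≤ C) :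
    Integrable (fun ω => f (occup Y n ω) (Y n ω)) μ :=
  Integrable.of_bound (measurable_state hY hn f).aestronglyMeasurable C
    (Eventually.of_forall fun ω => hf _ (occup_mem_simplex hd hn ω) _)

theorem integrable_mul_indicator [IsFiniteMeasure μ] (hd : 0 < d) (hY : ∀ n, Measurable (Y n))
    {n : ℕ} (hn : d ≤ n) {f : (Fin d → ℝ) → Fin d → ℝ} {C : ℝ}
    (hf : ∀ v ∈ simplex d, ∀ i, |f v i| ≤ C) (j : Fin d) :
    Integrable (fun ω => f (occup Y n ω) j * if Y (n + 1) ω = j then 1 else 0) μ := by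
  refine Integrable.of_bound (Measurable.aestronglyMeasurable ?_) C
    (Eventually.of_forall fun ω => ?_)
  · exact (measurable_state hY hn fun v _ => f v j).mul
      (Measurable.ite (hY (n + 1) (measurableSet_singleton j)) measurable_const measurable_const)
  · have h := hf (occup Y n ω) (occup_mem_simplex hd hn ω) j
    split_ifs
    · simpa using h
    · simpa using (abs_nonneg _).trans h

theorem integrable_state_succ [IsFiniteMeasure μ] (hd : 0 < d) (hY : ∀ n, Measurable (Y n))
    {n : ℕ} (hn : d ≤ n) {f : (Fin d → ℝ) → Fin d → ℝ} {C : ℝ}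
    (hf : ∀ v ∈ simplex d, ∀ i, |f v i| ≤ C) :
    Integrable (fun ω => f (occup Y n ω) (Y (n + 1) ω)) μ := by
  simp only [state_succ_eq_sum]
  exact integrable_finsetSum _ fun j _ => integrable_mul_indicator hd hY hn hf j

theorem mulVec_mmat_le (hR : ∀ i j, 0 < R i j) (hv : v ∈ simplex d) {x : Fin d → ℝ} {C : ℝ}
    (hx : ∀ i, |x i| ≤ C) (i : Fin d) : |(Mmat R v).mulVec x i| ≤ C := by
  calc |∑ j, Mmat R v i j * x j| ≤ ∑ j, Mmat R v i j * C := by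
        refine (Finset.abs_sum_le_sum_abs _ _).trans (Finset.sum_le_sum fun j _ => ?_)
        rw [abs_mul, abs_of_nonneg (mmat_nonneg hR hv i j)]
        exact mul_le_mul_of_nonneg_left (hx j) (mmat_nonneg hR hv i j)
    _ = C := by rw [← Finset.sum_mul, sum_mmat hR hv, one_mul]

/-- The transition rule in integrated form. -/
theorem integral_state_succ [IsProbabilityMeasure μ] (hd : 0 < d) (hR : ∀ i j, 0 < R i j)
    (hY : IsVRRW μ R Y) {n : ℕ} (hn : d ≤ n) {f : (Fin d → ℝ) → Fin d → ℝ} {C : ℝ}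
    (hf : ∀ v ∈ simplex d, ∀ i, |f v i| ≤ C) :
    ∫ ω, f (occup Y n ω) (Y (n + 1) ω) ∂μ
      = ∫ ω, (Mmat R (occup Y n ω)).mulVec (f (occup Y n ω)) (Y n ω) ∂μ := by
  obtain ⟨hmeas, -, htrans⟩ := hY
  have hterm : ∀ j, ∫ ω, f (occup Y n ω) j * (if Y (n + 1) ω = j then 1 else 0) ∂μ
      = ∫ ω, Mmat R (occup Y n ω) (Y n ω) j * f (occup Y n ω) j ∂μ := by
    intro j
    rw [← integral_condExp (natFilt_le hmeas n)]
    refine integral_congr_ae ?_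
    have hind : Integrable (fun ω => if Y (n + 1) ω = j then (1 : ℝ) else 0) μ := by
      simpa using integrable_mul_indicator (μ := μ) (f := fun _ _ => 1) (C := 1) hd hmeas hn
        (by simp) j
    have hpull := condExp_mul_of_stronglyMeasurable_left (μ := μ)
      (measurable_natFilt_state (Y := Y) hn fun v _ => f v j).stronglyMeasurable
      (integrable_mul_indicator hd hmeas hn hf j) hind
    filter_upwards [hpull, htrans n hn j] with ω h1 h2
    refine h1.trans ?_
    rw [Pi.mul_apply, h2, mmat_occup hd hn, mul_comm]
  have hint : ∀ j, Integrable
      (fun ω => Mmat R (occup Y n ω) (Y n ω) j * f (occup Y n ω) j) μ := by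
    intro j
    refine integrable_state (f := fun v i => Mmat R v i j * f v j) (C := C) hd hmeas hn
      fun v hv i => ?_
    rw [abs_mul, abs_of_nonneg (mmat_nonneg hR hv i j)]
    refine (mul_le_of_le_one_left (abs_nonneg _) ?_).trans (hf v hv j)
    rw [← sum_mmat hR hv i]
    exact Finset.single_le_sum (fun k _ => mmat_nonneg hR hv i k) (Finset.mem_univ j)
  simp only [state_succ_eq_sum, Matrix.mulVec, dotProduct]
  rw [integral_finsetSum _ fun j _ => integrable_mul_indicator hd hmeas hn hf j,
    integral_finsetSum _ fun j _ => hint j]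
  exact Finset.sum_congr rfl fun j _ => hterm j

theorem ae_summable_of_summable_integral {f : ℕ → Ω → ℝ} (hf0 : ∀ k ω, 0 ≤ f k ω)
    (hf : ∀ k, Integrable (f k) μ) (hsum : Summable fun k => ∫ ω, f k ω ∂μ) :
    ∀ᵐ ω ∂μ, Summable fun k => f k ω := by
  have hm : ∀ k, AEMeasurable (fun ω => ENNReal.ofReal (f k ω)) μ := fun k =>
    (hf k).aemeasurable.ennreal_ofReal
  have hfin : ∫⁻ ω, ∑' k, ENNReal.ofReal (f k ω) ∂μ ≠ ⊤ := by
    rw [lintegral_tsum hm]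
    simp only [← ofReal_integral_eq_lintegral_ofReal (hf _) (Eventually.of_forall (hf0 _))]
    exact hsum.tsum_ofReal_ne_top
  filter_upwards [ae_lt_top' (AEMeasurable.tsum hm) hfin] with ω hω
  simpa only [ENNReal.toReal_ofReal (hf0 _ ω)] using ENNReal.summable_toReal hω.ne

theorem ae_summable_drift [IsProbabilityMeasure μ] (hd : 0 < d) (hsymm : R.IsSymm)
    (hR : ∀ i j, 0 < R i j) (hY : IsVRRW μ R Y) :
    ∀ᵐ ω ∂μ, Summable fun k : ℕ =>
      (((d + k : ℕ) : ℝ) + 1)⁻¹ * drift R (occup Y (d + k) ω) := by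
  obtain ⟨u, Φ, C, hu, hΦ, hstep⟩ := exists_potential hsymm hR
  obtain ⟨B, -, hB, -⟩ := exists_bound_lipschitz (contDiffOn_drift hR)
  set γ : ℕ → ℝ := fun k => (((d + k : ℕ) : ℝ) + 1)⁻¹ with hγ
  have hγ0 : ∀ k, 0 ≤ γ k := fun k => by positivity
  have hsq : Summable fun k => γ k ^ 2 := by
    have h := (summable_nat_add_iff (d + 1)).2 (Real.summable_nat_pow_inv.2 one_lt_two)
    refine h.congr fun k => ?_
    rw [hγ, inv_pow]
    push_cast
    congr 2
    ring
  have hdle : ∀ k, d ≤ d + k := fun k => Nat.le_add_right d k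
  have hdint : ∀ k, Integrable (fun ω => γ k * drift R (occup Y (d + k) ω)) μ := fun k =>
    (integrable_state (f := fun v _ => drift R v) hd hY.1 (hdle k)
      fun v hv _ => hB v hv).const_mul _
  have hΦint : ∀ k, Integrable (fun ω => Φ (d + k) (occup Y (d + k) ω) (Y (d + k) ω)) μ :=
    fun k => integrable_state hd hY.1 (hdle k) (hΦ (d + k))
  refine ae_summable_of_summable_integral
    (fun k ω => mul_nonneg (hγ0 k) (drift_nonneg hR (occup_mem_simplex hd (hdle k) ω))) hdint ?_
  set a : ℕ → ℝ := fun k => ∫ ω, Φ (d + k) (occup Y (d + k) ω) (Y (d + k) ω) ∂μ with ha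
  have hbd : ∀ k, |a k| ≤ C := fun k => by
    have h := norm_integral_le_of_norm_le_const (μ := μ) (C := C)
      (f := fun ω => Φ (d + k) (occup Y (d + k) ω) (Y (d + k) ω))
      (Eventually.of_forall fun ω => hΦ (d + k) _ (occup_mem_simplex hd (hdle k) ω) _)
    simpa using h
  have hone : ∀ k, 2 * ∫ ω, γ k * drift R (occup Y (d + k) ω) ∂μ
      ≤ a (k + 1) - a k + C * γ k ^ 2 := by
    intro k
    have h1 : Integrable (fun ω => u (occup Y (d + k) ω) (Y (d + k + 1) ω)) μ :=
      integrable_state_succ hd hY.1 (hdle k) hu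
    have h2 : Integrable (fun ω =>
        (Mmat R (occup Y (d + k) ω)).mulVec (u (occup Y (d + k) ω)) (Y (d + k) ω)) μ :=
      integrable_state (f := fun v i => (Mmat R v).mulVec (u v) i) hd hY.1 (hdle k)
        fun v hv i => mulVec_mmat_le hR hv (hu v hv) i
    have h12 : Integrable (fun ω => u (occup Y (d + k) ω) (Y (d + k + 1) ω)
        - (Mmat R (occup Y (d + k) ω)).mulVec (u (occup Y (d + k) ω)) (Y (d + k) ω)) μ :=
      h1.sub h2
    have hΦΦ : Integrable (fun ω => Φ (d + (k + 1)) (occup Y (d + (k + 1)) ω) (Y (d + (k + 1)) ω)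
        - Φ (d + k) (occup Y (d + k) ω) (Y (d + k) ω)) μ :=
      (hΦint (k + 1)).sub (hΦint k)
    have hleft : ∫ ω, (2 * (γ k * drift R (occup Y (d + k) ω))
          + 2 * γ k * (u (occup Y (d + k) ω) (Y (d + k + 1) ω)
            - (Mmat R (occup Y (d + k) ω)).mulVec (u (occup Y (d + k) ω)) (Y (d + k) ω))) ∂μ
        = 2 * ∫ ω, γ k * drift R (occup Y (d + k) ω) ∂μ := by
      rw [integral_add ((hdint k).const_mul 2) (h12.const_mul (2 * γ k)),
        integral_const_mul 2, integral_const_mul (2 * γ k), integral_sub h1 h2,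
        integral_state_succ hd hR hY (hdle k) hu, sub_self, mul_zero, add_zero]
    have hright : ∫ ω, (Φ (d + (k + 1)) (occup Y (d + (k + 1)) ω) (Y (d + (k + 1)) ω)
          - Φ (d + k) (occup Y (d + k) ω) (Y (d + k) ω) + C * γ k ^ 2) ∂μ
        = a (k + 1) - a k + C * γ k ^ 2 := by
      rw [integral_add hΦΦ (integrable_const _),
        integral_sub (hΦint (k + 1)) (hΦint k)]
      simp [ha]
    rw [← hleft, ← hright]
    exact integral_mono
      (((hdint k).const_mul 2).add (h12.const_mul (2 * γ k)))
      (hΦΦ.add (integrable_const (C * γ k ^ 2)))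
      (fun ω => hstep (d + k) _ (occup_mem_simplex hd (hdle k) ω) _
        (occup_mem_simplex hd (hdle (k + 1)) ω) _ _ (occup_succ hd (hdle k) ω))
  refine summable_of_sum_range_le (c := C + C * ∑' k, γ k ^ 2)
    (fun k => integral_nonneg fun ω => mul_nonneg (hγ0 k)
      (drift_nonneg hR (occup_mem_simplex hd (hdle k) ω))) fun n => ?_
  have hsum := Finset.sum_le_sum fun k (_ : k ∈ Finset.range n) => hone k
  rw [← Finset.mul_sum, Finset.sum_add_distrib, Finset.sum_range_sub, ← Finset.mul_sum] at hsum
  have hC : 0 ≤ C := (abs_nonneg _).trans (hbd 0)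
  have hle : ∑ k ∈ Finset.range n, γ k ^ 2 ≤ ∑' k, γ k ^ 2 :=
    hsq.sum_le_tsum _ fun k _ => sq_nonneg _
  have h1 := mul_le_mul_of_nonneg_left hle hC
  have h2 := (abs_le.1 (hbd n)).2
  have h3 := (abs_le.1 (hbd 0)).1
  have h4 : 0 ≤ C * ∑' k, γ k ^ 2 := mul_nonneg hC (tsum_nonneg fun k => sq_nonneg _)
  linarith

end VRRW

/-- If all off-diagonal entries of `R` are positive and all principal
submatrices of `R` are invertible, then `V(n)` converges almost surely. -/
theorem stmt4 {d : ℕ} (hd : 2 ≤ d) (R : Matrix (Fin d) (Fin d) ℝ)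
    (hsymm : R.IsSymm) (hnonneg : ∀ i j, 0 ≤ R i j) (hcol : ∀ j, 0 < ∑ i, R i j)
    (hoff : ∀ i j, i ≠ j → 0 < R i j)
    (hminor : ∀ s : Finset (Fin d), s.Nonempty →
      IsUnit (R.submatrix (fun i : s => (i : Fin d)) (fun j : s => (j : Fin d))).det)
    {Ω : Type} [MeasurableSpace Ω] (μ : Measure Ω) [IsProbabilityMeasure μ]
    (Y : ℕ → Ω → Fin d) (hY : IsVRRW μ R Y) :
    ∀ᵐ ω ∂μ, ∃ p : Fin d → ℝ, Tendsto (fun n => occup Y n ω) atTop (nhds p) := by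
  have hd0 : 0 < d := by omega
  have hR : ∀ i j, 0 < R i j := by
    intro i j
    rcases eq_or_ne i j with rfl | hij
    · refine (hnonneg i i).lt_of_ne' ?_
      simpa using (hminor {i} (Finset.singleton_nonempty i)).ne_zero
    · exact hoff i j hij
  obtain ⟨C, -, -, hlip⟩ := exists_bound_lipschitz (contDiffOn_drift hR)
  have hdle : ∀ k, d ≤ d + k := fun k => Nat.le_add_right d k
  have hshift : Tendsto (fun k : ℕ => (((d + k : ℕ) : ℝ) + 1)⁻¹) atTop (nhds 0) := by
    have h := (tendsto_add_atTop_iff_nat d).2 (tendsto_one_div_add_atTop_nhds_zero_nat (𝕜 := ℝ))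
    refine h.congr fun k => ?_
    rw [one_div, add_comm k d]
  filter_upwards [ae_summable_drift hd0 hsymm hR hY] with ω hω
  have hmem : ∀ k, occup Y (d + k) ω ∈ simplex d := fun k =>
    occup_mem_simplex hd0 (hdle k) ω
  have hdrift : Tendsto (fun k => drift R (occup Y (d + k) ω)) atTop (nhds 0) := by
    refine tendsto_zero_of_summable_mul (C := max C 0) (fun k => drift_nonneg hR (hmem k))
      (fun k => ?_) (fun k => ?_) ?_ ?_ hω
    · positivity
    · refine (hlip _ (hmem (k + 1)) _ (hmem k)).trans ?_
      exact mul_le_mul (le_max_left _ _) (norm_occup_succ_sub_le hd0 (hdle k) ω) (norm_nonneg _)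
        (le_max_right _ _)
    · have h := (summable_nat_add_iff (d + 1)).2 (Real.summable_nat_pow_inv.2 one_lt_two)
      refine h.congr fun k => ?_
      rw [inv_pow]
      push_cast
      congr 2
      ring
    · intro h
      refine Real.not_summable_natCast_inv ((summable_nat_add_iff (d + 1)).1 (h.congr fun k => ?_))
      push_cast
      congr 1
      ring
  obtain ⟨p, hp⟩ := exists_tendsto_of_finite_zeros isCompact_simplex
    (contDiffOn_drift hR).continuousOn (finite_drift_zeros hR hminor) hmem
    (squeeze_zero (fun k => dist_nonneg) (fun k => by
      rw [dist_eq_norm]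
      exact norm_occup_succ_sub_le hd0 (hdle k) ω) hshift) hdrift
  refine ⟨p, (tendsto_add_atTop_iff_nat d).1 (hp.congr fun k => ?_)⟩
  rw [add_comm d k]
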